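/- Let κ be an infinite cardinal, T a κ-tree, D a fine filter over a directed partial order I with cf(κ) > |I|, ⟨f_β : β < κ⟩ a D-ascent path through T, and for each ε < 2 let (Y_ε, B_ε) be a thread through ⟨f_β : β < κ⟩. Then there exists X ⊆ Y_0 ∩ Y_1 with X ∈ D such that B_0^X = B_1^X, where B_ε^X := {α < κ : f_α(i) ⊆ f_{min(B_ε \ α)}(i) for all i ∈ X}. -/

import Mathlib

universe u

/-- A node of a binary tree: a pair `(α, s)` coding the function `t : α → 2` whose value
is `1` exactly on `s ⊆ α`. -/
abbrev TreeNode : Type (u+1) := Ordinal.{u} × Set Ordinal.{u}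

/-- The tree order: `s` is an initial segment of `t`. -/
def TreeLE (s t : TreeNode.{u}) : Prop :=
  s.1 ≤ t.1 ∧ s.2 = t.2 ∩ Set.Iio s.1

/-- A binary tree: a set of nodes closed under restrictions. -/
def IsBinaryTree (T : Set TreeNode.{u}) : Prop :=
  (∀ t ∈ T, t.2 ⊆ Set.Iio t.1) ∧
  (∀ t ∈ T, ∀ β ≤ t.1, ((β, t.2 ∩ Set.Iio β) : TreeNode.{u}) ∈ T)

/-- A `κ`-tree: a binary tree of height `κ` all of whose levels have size `< κ`. -/
def IsKappaTree (κ : Cardinal.{u}) (T : Set TreeNode.{u}) : Prop :=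
  IsBinaryTree T ∧
  (∀ t ∈ T, t.1 < κ.ord) ∧
  (∀ α < κ.ord, ∃ t ∈ T, t.1 = α) ∧
  (∀ α < κ.ord, Cardinal.mk {t : TreeNode.{u} // t ∈ T ∧ t.1 = α} < Cardinal.lift.{u+1} κ)

/-- A `κ`-Aronszajn tree: a `κ`-tree with no chain of size `κ`. -/
def IsAronszajnTree (κ : Cardinal.{u}) (T : Set TreeNode.{u}) : Prop :=
  IsKappaTree κ T ∧
  ¬ ∃ B : Set TreeNode.{u}, B ⊆ T ∧
      (∀ s ∈ B, ∀ t ∈ B, TreeLE s t ∨ TreeLE t s) ∧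
      Cardinal.mk B = Cardinal.lift.{u+1} κ


/-- A `D`-ascent path through a tree of height `κ`: functions `f_β : I → T_β` such that
for all `α < β < κ`, `{i : f_α(i) ⊆ f_β(i)} ∈ D`. -/
def IsAscentPath {I : Type u} [Preorder I] (κ : Cardinal.{u}) (T : Set TreeNode.{u})
    (D : Filter I) (f : Ordinal.{u} → I → TreeNode.{u}) : Prop :=
  (∀ β < κ.ord, ∀ i : I, f β i ∈ T ∧ (f β i).1 = β) ∧
  (∀ α β : Ordinal.{u}, α < β → β < κ.ord → {i : I | TreeLE (f α i) (f β i)} ∈ D)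

/-- A thread `(Y, B)` through a `D`-ascent path `f`. -/
def IsThread {I : Type u} [Preorder I] (κ : Cardinal.{u}) (D : Filter I)
    (f : Ordinal.{u} → I → TreeNode.{u}) (Y : Set I) (B : Set Ordinal.{u}) : Prop :=
  Y ∈ D ∧
  B ⊆ Set.Iio κ.ord ∧
  (∀ α < κ.ord, ∃ β ∈ B, α ≤ β) ∧
  (∀ α ∈ B, ∀ β ∈ B, α < β → ∀ i ∈ Y, TreeLE (f α i) (f β i)) ∧
  (∀ α < κ.ord, (∃ β ∈ B, α < β ∧ ∀ i ∈ Y, TreeLE (f α i) (f β i)) → α ∈ B)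

/-- `B^X := {α < κ : f_α(i) ⊆ f_{min(B \ α)}(i) for all i ∈ X}`. -/
def threadRestrict {I : Type u} [Preorder I] (κ : Cardinal.{u})
    (f : Ordinal.{u} → I → TreeNode.{u}) (B : Set Ordinal.{u}) (X : Set I) :
    Set Ordinal.{u} :=
  {α : Ordinal.{u} | α < κ.ord ∧
    ∀ i ∈ X, TreeLE (f α i) (f (sInf {β : Ordinal.{u} | β ∈ B ∧ α ≤ β}) i)}

theorem TreeLE.rfl_of_mem {T : Set TreeNode.{u}} (hT : IsBinaryTree T) {t : TreeNode.{u}}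
    (ht : t ∈ T) : TreeLE t t :=
  ⟨le_rfl, (Set.inter_eq_left.2 (hT.1 t ht)).symm⟩

theorem TreeLE.mem_iff {s t : TreeNode.{u}} (h : TreeLE s t) {ξ : Ordinal.{u}} (hξ : ξ < s.1) :
    ξ ∈ s.2 ↔ ξ ∈ t.2 := by
  rw [h.2]
  exact ⟨fun h => h.1, fun h => ⟨h, hξ⟩⟩

/-- The two families of nodes `f β i`, for `β ∈ B₀` and `β ∈ B₁`, agree wherever both are
defined, i.e. they determine the same branch. -/
def SameBranch {I : Type u} (f : Ordinal.{u} → I → TreeNode.{u}) (B₀ B₁ : Set Ordinal.{u})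
    (i : I) : Prop :=
  ∀ β ∈ B₀, ∀ γ ∈ B₁, ∀ ξ < min β γ, ξ ∈ (f β i).2 ↔ ξ ∈ (f γ i).2

theorem SameBranch.symm {I : Type u} {f : Ordinal.{u} → I → TreeNode.{u}}
    {B₀ B₁ : Set Ordinal.{u}} {i : I} (h : SameBranch f B₀ B₁ i) : SameBranch f B₁ B₀ i :=
  fun β hβ γ hγ ξ hξ => (h γ hγ β hβ ξ (min_comm β γ ▸ hξ)).symm

theorem IsThread.sInf_mem {I : Type u} [Preorder I] {κ : Cardinal.{u}} {D : Filter I}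
    {f : Ordinal.{u} → I → TreeNode.{u}} {Y : Set I} {B : Set Ordinal.{u}}
    (h : IsThread κ D f Y B) {α : Ordinal.{u}} (hα : α < κ.ord) :
    sInf {β : Ordinal.{u} | β ∈ B ∧ α ≤ β} ∈ {β : Ordinal.{u} | β ∈ B ∧ α ≤ β} :=
  csInf_mem (h.2.2.1 α hα)

theorem threadRestrict_subset {I : Type u} [Preorder I] {κ : Cardinal.{u}} {T : Set TreeNode.{u}}
    {D : Filter I} {f : Ordinal.{u} → I → TreeNode.{u}} (hf : IsAscentPath κ T D f)
    {Y₀ Y₁ X : Set I} {B₀ B₁ : Set Ordinal.{u}}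
    (h₀ : IsThread κ D f Y₀ B₀) (h₁ : IsThread κ D f Y₁ B₁)
    (hX : ∀ i ∈ X, SameBranch f B₀ B₁ i) :
    threadRestrict κ f B₀ X ⊆ threadRestrict κ f B₁ X := by
  rintro α ⟨hα, h⟩
  refine ⟨hα, fun i hi => ?_⟩
  obtain ⟨hm₀, hle₀⟩ := h₀.sInf_mem hα
  obtain ⟨hm₁, hle₁⟩ := h₁.sInf_mem hα
  have hd := (hf.1 α hα i).2
  refine ⟨?_, ?_⟩
  · rw [hd, (hf.1 _ (h₁.2.1 hm₁) i).2]
    exact hle₁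
  · rw [(h i hi).2, hd]
    ext ξ
    refine and_congr_left fun hξ => ?_
    exact hX i hi _ hm₀ _ hm₁ ξ (lt_min (lt_of_lt_of_le hξ hle₀) (lt_of_lt_of_le hξ hle₁))

theorem IsThread.treeLE {I : Type u} [Preorder I] {κ : Cardinal.{u}} {T : Set TreeNode.{u}}
    (hT : IsBinaryTree T) {D : Filter I} {f : Ordinal.{u} → I → TreeNode.{u}}
    (hf : IsAscentPath κ T D f) {Y : Set I} {B : Set Ordinal.{u}} (h : IsThread κ D f Y B)
    {α β : Ordinal.{u}} (hα : α ∈ B) (hβ : β ∈ B) (hαβ : α ≤ β) {i : I} (hi : i ∈ Y) :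
    TreeLE (f α i) (f β i) := by
  rcases hαβ.eq_or_lt with rfl | hlt
  · exact TreeLE.rfl_of_mem hT (hf.1 α (h.2.1 hα) i).1
  · exact h.2.2.2.1 α hα β hβ hlt i hi

theorem sameBranch_mem {I : Type u} [Preorder I] {κ : Cardinal.{u}}
    (hκ : Cardinal.aleph0 ≤ κ) (hcof : Cardinal.mk I < (κ.ord).cof) {T : Set TreeNode.{u}}
    (hT : IsBinaryTree T) {D : Filter I} {f : Ordinal.{u} → I → TreeNode.{u}}
    (hf : IsAscentPath κ T D f) {Y₀ Y₁ : Set I} {B₀ B₁ : Set Ordinal.{u}}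
    (h₀ : IsThread κ D f Y₀ B₀) (h₁ : IsThread κ D f Y₁ B₁) :
    {i | SameBranch f B₀ B₁ i} ∈ D := by
  have hlim := Cardinal.isSuccLimit_ord hκ
  have key : ∀ i : I, ∃ δ < κ.ord, ¬ SameBranch f B₀ B₁ i →
      ∃ β ∈ B₀, ∃ γ ∈ B₁, β ≤ δ ∧ γ ≤ δ ∧ ∃ ξ < min β γ, ¬ (ξ ∈ (f β i).2 ↔ ξ ∈ (f γ i).2) := by
    intro i
    by_cases hi : SameBranch f B₀ B₁ i
    · exact ⟨0, hlim.bot_lt, fun h => absurd hi h⟩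
    · have hi' := hi
      simp only [SameBranch, not_forall] at hi'
      obtain ⟨β, hβ, γ, hγ, ξ, hξ, hne⟩ := hi'
      exact ⟨max β γ, max_lt (h₀.2.1 hβ) (h₁.2.1 hγ), fun _ =>
        ⟨β, hβ, γ, hγ, le_max_left _ _, le_max_right _ _, ξ, hξ, hne⟩⟩
  choose δ hδ hδ' using key
  have hsup : ⨆ i, δ i < κ.ord := Ordinal.iSup_lt_of_lt_cof hcof hδ
  obtain ⟨β', hβ', hle₀⟩ := h₀.2.2.1 _ hsup
  obtain ⟨γ', hγ', hle₁⟩ := h₁.2.2.1 _ (hlim.succ_lt (h₀.2.1 hβ'))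
  have hlt : β' < γ' := (Order.lt_succ β').trans_le hle₁
  filter_upwards [h₀.1, h₁.1, hf.2 β' γ' hlt (h₁.2.1 hγ')] with i hi₀ hi₁ hi
  by_contra hbad
  obtain ⟨β, hβ, γ, hγ, hβδ, hγδ, ξ, hξ, hne⟩ := hδ' i hbad
  have hδle : δ i ≤ β' := (Ordinal.le_iSup δ i).trans hle₀
  have hββ' := hβδ.trans hδle
  have hγγ' := (hγδ.trans hδle).trans hlt.le
  have hdβ := (hf.1 β (h₀.2.1 hβ) i).2
  have hdγ := (hf.1 γ (h₁.2.1 hγ) i).2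
  have hdβ' := (hf.1 β' (h₀.2.1 hβ') i).2
  obtain ⟨hξβ, hξγ⟩ := lt_min_iff.1 hξ
  apply hne
  rw [(h₀.treeLE hT hf hβ hβ' hββ' hi₀).mem_iff (hdβ.symm ▸ hξβ),
    (h₁.treeLE hT hf hγ hγ' hγγ' hi₁).mem_iff (hdγ.symm ▸ hξγ)]
  exact TreeLE.mem_iff hi (hdβ'.symm ▸ hξβ.trans_le hββ')

/-- if `cf(κ) > |I|` and `(Y₀, B₀)`, `(Y₁, B₁)` are threads through a
`D`-ascent path, then there is `X ⊆ Y₀ ∩ Y₁` in `D` with `B₀^X = B₁^X`. -/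
theorem stmt13 {I : Type u} [PartialOrder I] [IsDirected I (· ≤ ·)]
    (κ : Cardinal.{u}) (hκ : Cardinal.aleph0 ≤ κ)
    (hcof : Cardinal.mk I < (κ.ord).cof)
    (T : Set TreeNode.{u}) (hT : IsKappaTree κ T)
    (D : Filter I) (hDne : D.NeBot) (hDfine : ∀ i : I, {j : I | i ≤ j} ∈ D)
    (f : Ordinal.{u} → I → TreeNode.{u}) (hf : IsAscentPath κ T D f)
    (Y₀ Y₁ : Set I) (B₀ B₁ : Set Ordinal.{u})
    (h₀ : IsThread κ D f Y₀ B₀) (h₁ : IsThread κ D f Y₁ B₁) :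
    ∃ X ∈ D, X ⊆ Y₀ ∩ Y₁ ∧ threadRestrict κ f B₀ X = threadRestrict κ f B₁ X := by
  have hX := sameBranch_mem hκ hcof hT.1 hf h₀ h₁
  refine ⟨Y₀ ∩ Y₁ ∩ {i | SameBranch f B₀ B₁ i},
    Filter.inter_mem (Filter.inter_mem h₀.1 h₁.1) hX, Set.inter_subset_left, ?_⟩
  exact (threadRestrict_subset hf h₀ h₁ fun i hi => hi.2).antisymm
    (threadRestrict_subset hf h₁ h₀ fun i hi => SameBranch.symm hi.2)
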